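/- There exists a universal constant c > 0 such that for every positive integer n and every Boolean function f : {-1,1}^n → {-1,1} with k(f) > 1, δ(f) ≥ c · max{ (1/k(f)) · (r(f)/log k(f))^2 , k(f)/k'(f)^2 }. -/

import Mathlib

open scoped BigOperators
open scoped Classical

noncomputable section

namespace BoolFunc

/-- Real value of a hypercube coordinate: `true ↦ -1`, `false ↦ 1`. -/
def signv (b : Bool) : ℝ := if b then -1 else 1

/-- Fourier coefficient `f̂(S)` of `f : {-1,1}ⁿ → ℝ`. -/
def fourierCoeff {n : ℕ} (f : (Fin n → Bool) → ℝ) (S : Finset (Fin n)) : ℝ :=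
  (∑ x : Fin n → Bool, f x * ∏ i ∈ S, signv (x i)) / 2 ^ n

/-- Fourier support of `f`. -/
def fourierSupport {n : ℕ} (f : (Fin n → Bool) → ℝ) : Finset (Finset (Fin n)) :=
  Finset.univ.filter (fun S => fourierCoeff f S ≠ 0)

/-- Fourier sparsity `k(f)`. -/
def sparsity {n : ℕ} (f : (Fin n → Bool) → ℝ) : ℕ := (fourierSupport f).card

/-- Indicator vector in `F₂ⁿ` of a subset of `[n]`. -/
def indicatorVec {n : ℕ} (S : Finset (Fin n)) : Fin n → ZMod 2 :=
  fun i => if i ∈ S then 1 else 0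

/-- Fourier rank `r(f)`: the `F₂`-dimension of the span of the Fourier support. -/
def fourierRank {n : ℕ} (f : (Fin n → Bool) → ℝ) : ℕ :=
  Module.finrank (ZMod 2)
    ↥(Submodule.span (ZMod 2)
      (indicatorVec '' (fourierSupport f : Set (Finset (Fin n)))))

/-- Weight `δ(f) = Pr[f(x) = -1]`. -/
def weight {n : ℕ} (f : (Fin n → Bool) → ℝ) : ℝ :=
  ((Finset.univ.filter (fun x : Fin n → Bool => f x = -1)).card : ℝ) / 2 ^ n

/-- Fourier max-supp-entropy `k'(f) = max_{S ∈ supp(f)} 1/|f̂(S)|`. -/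
def maxSuppEntropy {n : ℕ} (f : (Fin n → Bool) → ℝ) : ℝ :=
  sSup ((fun S => 1 / |fourierCoeff f S|) '' (fourierSupport f : Set (Finset (Fin n))))

/-- Dimension of the span of `{S : |f̂(S)| ≥ 1/t}`. -/
def levelDim {n : ℕ} (f : (Fin n → Bool) → ℝ) (t : ℝ) : ℕ :=
  Module.finrank (ZMod 2)
    ↥(Submodule.span (ZMod 2)
      (indicatorVec '' {S : Finset (Fin n) | 1 / t ≤ |fourierCoeff f S|}))

/-- Fourier max-rank-entropy `k''(f)`. -/
def maxRankEntropy {n : ℕ} (f : (Fin n → Bool) → ℝ) : ℝ :=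
  sInf {t : ℝ | 0 < t ∧ levelDim f t = fourierRank f}

/-- `f` is Boolean-valued (takes values in `{-1,1}`). -/
def IsBooleanFunc {n : ℕ} (f : (Fin n → Bool) → ℝ) : Prop := ∀ x, f x = 1 ∨ f x = -1

/-- The nontrivial additive character of `F₂`, with real values. -/
def sgn (a : ZMod 2) : ℝ := if a = 0 then 1 else -1

/-- The character of `F₂ⁿ` indexed by `a`. -/
def chi {n : ℕ} (a y : Fin n → ZMod 2) : ℝ := sgn (a ⬝ᵥ y)

/-- Fourier coefficient of a function on `F₂ⁿ`. -/
def hat {n : ℕ} (f : (Fin n → ZMod 2) → ℝ) (a : Fin n → ZMod 2) : ℝ :=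
  (∑ y, f y * chi a y) / 2 ^ n

/-- The pullback of `f` along the affine map `y ↦ x + M y`. -/
def affinePullback {n : ℕ} (f : (Fin n → ZMod 2) → ℝ) (M : Matrix (Fin n) (Fin n) (ZMod 2))
    (x : Fin n → ZMod 2) : (Fin n → ZMod 2) → ℝ :=
  fun y => f (x + M.mulVec y)

/-- The nonzero elements of the Fourier support. -/
def nonzeroSupport {n : ℕ} (f : (Fin n → ZMod 2) → ℝ) : Finset (Fin n → ZMod 2) :=
  Finset.univ.filter (fun a => a ≠ 0 ∧ hat f a ≠ 0)

/-- The nonzero elements of the image of the Fourier support under `a ↦ a M`. -/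
def foldedSupport {n : ℕ} (f : (Fin n → ZMod 2) → ℝ) (M : Matrix (Fin n) (Fin n) (ZMod 2)) :
    Finset (Fin n → ZMod 2) :=
  Finset.univ.filter (fun b => b ≠ 0 ∧ ∃ a, hat f a ≠ 0 ∧ Matrix.vecMul a M = b)

/-- The weight of a `±1`-valued function on `F₂ⁿ`, read off its mean. -/
def density {n : ℕ} (f : (Fin n → ZMod 2) → ℝ) : ℝ := (1 - hat f 0) / 2

/-- The dimension of the left kernel of `M`. -/
def kerDim {n : ℕ} (M : Matrix (Fin n) (Fin n) (ZMod 2)) : ℕ :=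
  Module.finrank (ZMod 2) (LinearMap.ker M.vecMulLinear)

section Fourier

variable {n : ℕ}

lemma zmod_two_eq_one {a : ZMod 2} (h : a ≠ 0) : a = 1 := by
  revert a; decide

lemma sgn_add (a b : ZMod 2) : sgn (a + b) = sgn a * sgn b := by
  have h11 : (1 + 1 : ZMod 2) = 0 := by decide
  by_cases ha : a = 0
  · simp [ha, sgn]
  · by_cases hb : b = 0
    · simp [hb, sgn]
    · rw [zmod_two_eq_one ha, zmod_two_eq_one hb, h11]
      simp [sgn]

lemma sgn_sum {ι : Type*} (s : Finset ι) (g : ι → ZMod 2) :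
    sgn (∑ i ∈ s, g i) = ∏ i ∈ s, sgn (g i) := by
  induction s using Finset.induction_on with
  | empty => simp [sgn]
  | insert i s hi ih => rw [Finset.sum_insert hi, Finset.prod_insert hi, sgn_add, ih]

lemma sgn_mul_self (a : ZMod 2) : sgn a * sgn a = 1 := by
  unfold sgn; split_ifs <;> norm_num

lemma chi_mul_self (a y : Fin n → ZMod 2) : chi a y * chi a y = 1 := sgn_mul_self _

lemma chi_ne_zero (a y : Fin n → ZMod 2) : chi a y ≠ 0 := by
  intro h; simpa [h] using chi_mul_self a y

lemma chi_comm (a y : Fin n → ZMod 2) : chi a y = chi y a := by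
  rw [chi, chi, dotProduct_comm]

lemma chi_add_left (a b y : Fin n → ZMod 2) : chi (a + b) y = chi a y * chi b y := by
  rw [chi, add_dotProduct, sgn_add]; rfl

lemma chi_add_right (a x y : Fin n → ZMod 2) : chi a (x + y) = chi a x * chi a y := by
  rw [chi, dotProduct_add, sgn_add]; rfl

lemma chi_mulVec (a y : Fin n → ZMod 2) (M : Matrix (Fin n) (Fin n) (ZMod 2)) :
    chi a (M.mulVec y) = chi (Matrix.vecMul a M) y := by
  rw [chi, chi, Matrix.dotProduct_mulVec]

lemma chi_zero_left (y : Fin n → ZMod 2) : chi 0 y = 1 := by simp [chi, sgn]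

lemma chi_zero_right (a : Fin n → ZMod 2) : chi a 0 = 1 := by simp [chi, sgn]

lemma exists_chi_eq_neg_one {a : Fin n → ZMod 2} (ha : a ≠ 0) : ∃ x, chi a x = -1 := by
  obtain ⟨i, hi⟩ := Function.ne_iff.mp ha
  refine ⟨Pi.single i 1, ?_⟩
  rw [chi, dotProduct_single, mul_one, zmod_two_eq_one hi]
  simp [sgn]

lemma card_vec : (Fintype.card (Fin n → ZMod 2) : ℝ) = 2 ^ n := by
  simp [ZMod.card]

lemma sum_chi (a : Fin n → ZMod 2) :
    ∑ y, chi a y = if a = 0 then (2 : ℝ) ^ n else 0 := by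
  split_ifs with h
  · subst h
    simp only [chi_zero_left, Finset.sum_const, Finset.card_univ, nsmul_eq_mul, mul_one]
    exact card_vec
  · obtain ⟨x, hx⟩ := exists_chi_eq_neg_one h
    have := Equiv.sum_comp (Equiv.addLeft x) (chi a)
    simp only [Equiv.coe_addLeft, chi_add_right, hx, ← Finset.mul_sum] at this
    linarith

lemma add_eq_zero_iff_eq_vec (a b : Fin n → ZMod 2) : a + b = 0 ↔ a = b := by
  constructor
  · intro h
    funext i
    have := congrFun h i
    simp only [Pi.add_apply, Pi.zero_apply] at this
    revert this
    generalize a i = u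
    generalize b i = v
    revert u v
    decide
  · rintro rfl
    exact funext fun i => CharTwo.add_self_eq_zero (a i)

lemma sum_chi_mul_chi (a b : Fin n → ZMod 2) :
    ∑ y, chi a y * chi b y = if a = b then (2 : ℝ) ^ n else 0 := by
  simp only [← chi_add_left, sum_chi, add_eq_zero_iff_eq_vec]

lemma sum_hat_mul_chi (f : (Fin n → ZMod 2) → ℝ) (y : Fin n → ZMod 2) :
    ∑ a, hat f a * chi a y = f y := by
  have h2 : (2 : ℝ) ^ n ≠ 0 := by positivity
  have : ∀ a, hat f a * chi a y = ∑ z, f z / 2 ^ n * (chi z a * chi y a) := by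
    intro a
    rw [hat, Finset.sum_div, Finset.sum_mul]
    refine Finset.sum_congr rfl fun z _ => ?_
    rw [chi_comm a z, chi_comm a y]; ring
  simp only [this]
  rw [Finset.sum_comm]
  simp only [← Finset.mul_sum, sum_chi_mul_chi]
  simp [h2]

lemma hat_sum_chi {ι : Type*} [Fintype ι] (c : ι → ℝ) (φ : ι → Fin n → ZMod 2)
    (b : Fin n → ZMod 2) :
    hat (fun y => ∑ a, c a * chi (φ a) y) b = ∑ a with φ a = b, c a := by
  have h2 : (2 : ℝ) ^ n ≠ 0 := by positivity
  rw [hat]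
  simp only [Finset.sum_mul, mul_assoc]
  rw [Finset.sum_comm]
  simp only [← Finset.mul_sum, sum_chi_mul_chi, Finset.sum_filter]
  rw [Finset.sum_div]
  refine Finset.sum_congr rfl fun a _ => ?_
  split_ifs <;> simp [h2]

lemma hat_affinePullback (f : (Fin n → ZMod 2) → ℝ) (M : Matrix (Fin n) (Fin n) (ZMod 2))
    (x b : Fin n → ZMod 2) :
    hat (affinePullback f M x) b = ∑ a with Matrix.vecMul a M = b, hat f a * chi a x := by
  rw [← hat_sum_chi]
  congr 1
  funext y
  rw [affinePullback, ← sum_hat_mul_chi f]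
  refine Finset.sum_congr rfl fun a _ => ?_
  rw [chi_add_right, chi_mulVec, mul_assoc]

lemma sum_sq_sum_chi (A : Finset (Fin n → ZMod 2)) (c : (Fin n → ZMod 2) → ℝ) :
    ∑ x, (∑ a ∈ A, c a * chi a x) ^ 2 = 2 ^ n * ∑ a ∈ A, c a ^ 2 := by
  have : ∀ x, (∑ a ∈ A, c a * chi a x) ^ 2
      = ∑ a ∈ A, ∑ b ∈ A, c a * c b * (chi a x * chi b x) := by
    intro x
    rw [sq, Finset.sum_mul_sum]
    refine Finset.sum_congr rfl fun a _ => Finset.sum_congr rfl fun b _ => by ring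
  simp only [this]
  rw [Finset.sum_comm, Finset.mul_sum]
  refine Finset.sum_congr rfl fun a ha => ?_
  rw [Finset.sum_comm]
  simp only [← Finset.mul_sum, sum_chi_mul_chi]
  simp [ha]; ring

/-- Uncertainty principle: a nonzero combination of `m` characters is nonzero on at least a
`1 / m` fraction of the points. -/
lemma two_pow_le_card_mul_card_ne_zero (A : Finset (Fin n → ZMod 2))
    (c : (Fin n → ZMod 2) → ℝ) (hc : ∃ a ∈ A, c a ≠ 0) :
    (2 : ℝ) ^ n ≤ (A.card : ℝ) *
      (Finset.univ.filter (fun x => ∑ a ∈ A, c a * chi a x ≠ 0)).card := by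
  set Q : ℝ := ∑ a ∈ A, c a ^ 2 with hQ
  have hQpos : 0 < Q := by
    obtain ⟨a, ha, hca⟩ := hc
    exact Finset.sum_pos' (fun _ _ => sq_nonneg _) ⟨a, ha, by positivity⟩
  have hbound : ∀ x, (∑ a ∈ A, c a * chi a x) ^ 2 ≤
      if ∑ a ∈ A, c a * chi a x ≠ 0 then (A.card : ℝ) * Q else 0 := by
    intro x
    split_ifs with h
    · refine (sq_sum_le_card_mul_sum_sq).trans (le_of_eq ?_)
      congr 1
      refine Finset.sum_congr rfl fun a _ => ?_
      rw [mul_pow, sq (chi a x), chi_mul_self, mul_one]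
    · push Not at h
      rw [h]; norm_num
  have h1 := Finset.sum_le_sum fun x (_ : x ∈ Finset.univ) => hbound x
  rw [sum_sq_sum_chi, ← Finset.sum_filter, Finset.sum_const, nsmul_eq_mul] at h1
  rw [← hQ] at h1
  exact le_of_mul_le_mul_right (by linarith) hQpos

end Fourier

section Boolean

variable {n : ℕ}

lemma affinePullback_eq_one_or {f : (Fin n → ZMod 2) → ℝ} (hf : ∀ y, f y = 1 ∨ f y = -1)
    (M : Matrix (Fin n) (Fin n) (ZMod 2)) (x : Fin n → ZMod 2) :
    ∀ y, affinePullback f M x y = 1 ∨ affinePullback f M x y = -1 := fun _ => hf _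

lemma sum_sq_hat {f : (Fin n → ZMod 2) → ℝ} (hf : ∀ y, f y = 1 ∨ f y = -1) :
    ∑ a, hat f a ^ 2 = 1 := by
  have h := sum_sq_sum_chi Finset.univ (hat f)
  simp only [sum_hat_mul_chi] at h
  have h1 : ∀ x, f x ^ 2 = 1 := fun x => by rcases hf x with h | h <;> rw [h] <;> norm_num
  simp only [h1, Finset.sum_const, Finset.card_univ, nsmul_eq_mul, mul_one, card_vec] at h
  have h2 : (2 : ℝ) ^ n ≠ 0 := by positivity
  exact mul_left_cancel₀ h2 (by linarith)

lemma sum_sq_nonzeroSupport {f : (Fin n → ZMod 2) → ℝ} (hf : ∀ y, f y = 1 ∨ f y = -1) :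
    ∑ a ∈ nonzeroSupport f, hat f a ^ 2 = 4 * density f * (1 - density f) := by
  have h := sum_sq_hat hf
  rw [← Finset.add_sum_erase _ _ (Finset.mem_univ 0)] at h
  have : ∑ a ∈ nonzeroSupport f, hat f a ^ 2 = ∑ a ∈ Finset.univ.erase 0, hat f a ^ 2 := by
    refine Finset.sum_subset (fun a ha => ?_) (fun a ha h' => ?_)
    · simp_all [nonzeroSupport]
    · simp_all [nonzeroSupport]
  rw [this, density]
  linarith

lemma density_nonneg {f : (Fin n → ZMod 2) → ℝ} (hf : ∀ y, f y = 1 ∨ f y = -1) :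
    0 ≤ density f := by
  have h : hat f 0 ^ 2 ≤ 1 := by
    rw [← sum_sq_hat hf]
    exact Finset.single_le_sum (f := fun a => hat f a ^ 2) (fun _ _ => sq_nonneg _)
      (Finset.mem_univ 0)
  unfold density
  nlinarith

lemma hat_neg (f : (Fin n → ZMod 2) → ℝ) (a : Fin n → ZMod 2) :
    hat (fun y => - f y) a = - hat f a := by
  simp [hat, neg_div]

lemma nonzeroSupport_neg (f : (Fin n → ZMod 2) → ℝ) :
    nonzeroSupport (fun y => - f y) = nonzeroSupport f := by
  simp [nonzeroSupport, hat_neg]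

lemma nonzeroSupport_affinePullback_subset (f : (Fin n → ZMod 2) → ℝ)
    (M : Matrix (Fin n) (Fin n) (ZMod 2)) (x : Fin n → ZMod 2) :
    nonzeroSupport (affinePullback f M x) ⊆ foldedSupport f M := by
  intro b hb
  simp only [nonzeroSupport, foldedSupport, Finset.mem_filter, Finset.mem_univ, true_and] at hb ⊢
  refine ⟨hb.1, ?_⟩
  rw [hat_affinePullback] at hb
  obtain ⟨a, ha, hne⟩ := Finset.exists_ne_zero_of_sum_ne_zero hb.2
  exact ⟨a, left_ne_zero_of_mul hne, (Finset.mem_filter.mp ha).2⟩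

lemma affinePullback_affinePullback (f : (Fin n → ZMod 2) → ℝ)
    (M N : Matrix (Fin n) (Fin n) (ZMod 2)) (x z : Fin n → ZMod 2) :
    affinePullback (affinePullback f M x) N z = affinePullback f (M * N) (x + M.mulVec z) := by
  funext y
  simp [affinePullback, Matrix.mulVec_add, add_assoc]

lemma kerDim_one : kerDim (1 : Matrix (Fin n) (Fin n) (ZMod 2)) = 0 := by
  unfold kerDim
  have : LinearMap.ker (1 : Matrix (Fin n) (Fin n) (ZMod 2)).vecMulLinear = ⊥ := by
    rw [LinearMap.ker_eq_bot']
    intro m hm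
    simpa using hm
  rw [this, finrank_bot]

lemma kerDim_mul_le (M N : Matrix (Fin n) (Fin n) (ZMod 2)) :
    kerDim (M * N) ≤ kerDim M + kerDim N := by
  unfold kerDim
  set K := LinearMap.ker (M * N).vecMulLinear
  let g : K →ₗ[ZMod 2] LinearMap.ker N.vecMulLinear :=
    (M.vecMulLinear.comp K.subtype).codRestrict _ (by
      rintro ⟨a, ha⟩
      simpa [K] using ha)
  have h := g.finrank_range_add_finrank_ker
  have h1 : Module.finrank (ZMod 2) (LinearMap.range g)
      ≤ Module.finrank (ZMod 2) (LinearMap.ker N.vecMulLinear) := Submodule.finrank_le _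
  have h2 : Module.finrank (ZMod 2) (LinearMap.ker g)
      ≤ Module.finrank (ZMod 2) (LinearMap.ker M.vecMulLinear) := by
    let j : LinearMap.ker g →ₗ[ZMod 2] LinearMap.ker M.vecMulLinear :=
      ((K.subtype).comp (LinearMap.ker g).subtype).codRestrict _ (by
        rintro ⟨⟨a, ha⟩, hag⟩
        have := congrArg Subtype.val (LinearMap.mem_ker.mp hag)
        simpa [g] using this)
    refine LinearMap.finrank_le_finrank_of_injective (f := j) ?_
    intro u v huv
    have := congrArg Subtype.val huv
    exact Subtype.ext (Subtype.ext this)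
  omega

/-- For `γ ≠ 0` there is an endomorphism of `F₂ⁿ` with kernel exactly `{0, γ}`. -/
lemma exists_matrix_fold {γ : Fin n → ZMod 2} (hγ : γ ≠ 0) :
    ∃ M : Matrix (Fin n) (Fin n) (ZMod 2), kerDim M ≤ 1 ∧
      ∀ a, Matrix.vecMul a M = 0 ↔ a = 0 ∨ a = γ := by
  obtain ⟨i, hi⟩ := Function.ne_iff.mp hγ
  have hi1 : γ i = 1 := zmod_two_eq_one hi
  let M : Matrix (Fin n) (Fin n) (ZMod 2) := 1 + Matrix.vecMulVec (Pi.single i 1) γ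
  have hM : ∀ a, Matrix.vecMul a M = a + a i • γ := by
    intro a
    simp [M, Matrix.vecMul_add, Matrix.vecMul_vecMulVec]
  have hker : ∀ a, Matrix.vecMul a M = 0 ↔ a = 0 ∨ a = γ := by
    intro a
    rw [hM, add_eq_zero_iff_eq_vec]
    constructor
    · intro h
      by_cases h0 : a i = 0
      · left; rw [h, h0, zero_smul]
      · right; rw [h, zmod_two_eq_one h0, one_smul]
    · rintro (rfl | rfl)
      · simp
      · rw [hi1, one_smul]
  refine ⟨M, ?_, hker⟩
  have hle : LinearMap.ker M.vecMulLinear ≤ Submodule.span (ZMod 2) {γ} := by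
    intro a ha
    rcases (hker a).mp (by simpa using ha) with h | h
    · rw [h]; exact Submodule.zero_mem _
    · rw [h]; exact Submodule.mem_span_singleton_self γ
  exact (Submodule.finrank_mono hle).trans (finrank_span_singleton hγ).le

end Boolean

section Folding

variable {n : ℕ}

lemma sum_card_fiber_le_card {α β : Type*} [DecidableEq β] (s : Finset α) (t : Finset β) (g : α → β) :
    ∑ b ∈ t, (s.filter fun a => g a = b).card ≤ s.card := by
  rw [Finset.sum_card_fiberwise_eq_card_filter]
  exact Finset.card_filter_le _ _

/-- Some nonzero coefficient is at least as large as the square root of the average energy. -/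
lemma exists_large_coeff {f : (Fin n → ZMod 2) → ℝ} (hf : ∀ y, f y = 1 ∨ f y = -1)
    (hne : (nonzeroSupport f).Nonempty) {K : ℝ} (hK : ((nonzeroSupport f).card : ℝ) ≤ K) :
    ∃ γ ∈ nonzeroSupport f, 4 * density f * (1 - density f) ≤ K * hat f γ ^ 2 := by
  obtain ⟨γ, hγ, hmax⟩ := Finset.exists_max_image _ (fun a => hat f a ^ 2) hne
  refine ⟨γ, hγ, ?_⟩
  rw [← sum_sq_nonzeroSupport hf]
  refine (Finset.sum_le_card_nsmul _ _ _ hmax).trans ?_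
  rw [nsmul_eq_mul]
  exact mul_le_mul_of_nonneg_right hK (sq_nonneg _)

lemma exists_mul_chi_eq_abs {γ : Fin n → ZMod 2} (hγ : γ ≠ 0) (c : ℝ) :
    ∃ x, c * chi γ x = |c| := by
  rcases le_total 0 c with h | h
  · exact ⟨0, by rw [chi_zero_right, mul_one, abs_of_nonneg h]⟩
  · obtain ⟨x, hx⟩ := exists_chi_eq_neg_one hγ
    exact ⟨x, by rw [hx, abs_of_nonpos h]; ring⟩

/-- One greedy step: restricting to a hyperplane decreases the weight by half of a given
Fourier coefficient. -/
lemma exists_fold {f : (Fin n → ZMod 2) → ℝ} {γ : Fin n → ZMod 2}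
    (hγ : γ ∈ nonzeroSupport f) :
    ∃ M x, kerDim M ≤ 1 ∧ density (affinePullback f M x) = density f - |hat f γ| / 2 ∧
      (nonzeroSupport (affinePullback f M x)).card < (nonzeroSupport f).card := by
  have hγ0 : γ ≠ 0 := (Finset.mem_filter.mp hγ).2.1
  obtain ⟨M, hM1, hM⟩ := exists_matrix_fold hγ0
  obtain ⟨x, hx⟩ := exists_mul_chi_eq_abs hγ0 (hat f γ)
  refine ⟨M, x, hM1, ?_, ?_⟩
  · have : (Finset.univ.filter fun a => Matrix.vecMul a M = 0) = {0, γ} := by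
      ext a; simp [hM]
    rw [density, hat_affinePullback, this, Finset.sum_pair hγ0.symm, hx, chi_zero_left, density]
    ring
  · have hsub : nonzeroSupport (affinePullback f M x) ⊆
        ((nonzeroSupport f).erase γ).image (fun a => Matrix.vecMul a M) := by
      intro b hb
      obtain ⟨hb0, a, ha, rfl⟩ := (Finset.mem_filter.mp
        (nonzeroSupport_affinePullback_subset f M x hb)).2
      have h0 : ¬ (a = 0 ∨ a = γ) := fun h => hb0 ((hM a).mpr h)
      push Not at h0
      refine Finset.mem_image_of_mem _ (Finset.mem_erase.mpr ⟨h0.2, ?_⟩)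
      simp [nonzeroSupport, h0.1, ha]
    calc _ ≤ _ := Finset.card_le_card hsub
      _ ≤ _ := Finset.card_image_le
      _ < _ := Finset.card_erase_lt_of_mem hγ

lemma sqrt_decrease {K d b : ℝ} (hK : 0 < K) (hd : d ≤ 1 / 2) (hb : 0 ≤ b)
    (hd' : 0 ≤ d - b / 2) (h : 4 * d * (1 - d) ≤ K * b ^ 2) (hbpos : 0 < b) :
    1 + 3 * √(K * (d - b / 2)) ≤ 3 * √(K * d) := by
  have hd0 : 0 ≤ d := by linarith
  set s := √(K * d) with hs
  set t := √(K * (d - b / 2)) with ht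
  have hs2 : s ^ 2 = K * d := Real.sq_sqrt (by positivity)
  have ht2 : t ^ 2 = K * (d - b / 2) := Real.sq_sqrt (by positivity)
  have ht0 : 0 ≤ t := Real.sqrt_nonneg _
  have hs0 : 0 < s := Real.sqrt_pos.mpr (mul_pos hK (by linarith))
  have hts : t ≤ s := Real.sqrt_le_sqrt (by nlinarith)
  have hKb : 0 ≤ K * b := by positivity
  -- `s² ≤ (K b)² / 2`
  have h1 : s ^ 2 * 2 ≤ (K * b) ^ 2 := by
    rw [hs2]
    nlinarith [mul_nonneg hK.le hd0, mul_le_mul_of_nonneg_left h hK.le,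
      mul_nonneg (mul_nonneg hK.le hd0) (by linarith : 0 ≤ 1 / 2 - d)]
  have h2 : s * (4 / 3) ≤ K * b := by
    apply le_of_sq_le_sq _ hKb
    nlinarith [sq_nonneg s]
  have h3 : (s - t) * (2 * s) ≥ K * b / 2 := by nlinarith
  nlinarith

lemma exists_constant_of_density_le_half (K : ℝ) (m : ℕ) :
    ∀ f : (Fin n → ZMod 2) → ℝ, (∀ y, f y = 1 ∨ f y = -1) → density f ≤ 1 / 2 →
      (nonzeroSupport f).card = m → (m : ℝ) ≤ K →
      ∃ M x, (kerDim M : ℝ) ≤ 3 * √(K * density f) ∧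
        nonzeroSupport (affinePullback f M x) = ∅ := by
  induction m using Nat.strong_induction_on with
  | _ m ih =>
    intro f hf hd hm hK
    rcases Finset.eq_empty_or_nonempty (nonzeroSupport f) with he | hne
    · refine ⟨1, 0, ?_, ?_⟩
      · rw [kerDim_one]; simp
      · have : affinePullback f 1 0 = f := by
          funext y; simp [affinePullback]
        rw [this, he]
    · have hKpos : 0 < K := by
        have : 0 < m := hm ▸ hne.card_pos
        exact lt_of_lt_of_le (by exact_mod_cast this) hK
      obtain ⟨γ, hγ, hlarge⟩ := exists_large_coeff hf hne (K := K) (by rw [hm]; exact hK)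
      obtain ⟨M, x, hM, hdens, hcard⟩ := exists_fold hγ
      set g := affinePullback f M x with hg
      have hgb : ∀ y, g y = 1 ∨ g y = -1 := affinePullback_eq_one_or hf M x
      have hb : 0 < |hat f γ| := abs_pos.mpr (Finset.mem_filter.mp hγ).2.2
      have hlt : (nonzeroSupport g).card < m := hm ▸ hcard
      obtain ⟨N, z, hN, hz⟩ := ih _ hlt g hgb (by linarith) rfl
        (le_trans (by exact_mod_cast hlt.le) hK)
      refine ⟨M * N, x + M.mulVec z, ?_, by rw [← affinePullback_affinePullback]; exact hz⟩
      have hnn := density_nonneg hgb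
      rw [hdens] at hnn hN
      have hstep := sqrt_decrease hKpos hd hb.le hnn (by rw [sq_abs]; exact hlarge) hb
      have hker : (kerDim (M * N) : ℝ) ≤ 1 + kerDim N := by
        exact_mod_cast (kerDim_mul_le M N).trans (by omega)
      linarith

/-- A Boolean function of sparsity `k` and weight `δ` is constant on an affine subspace of
codimension `O(√(k δ))`. -/
lemma exists_constant {f : (Fin n → ZMod 2) → ℝ} (hf : ∀ y, f y = 1 ∨ f y = -1) :
    ∃ M x, (kerDim M : ℝ) ≤ 3 * √((nonzeroSupport f).card * density f) ∧
      nonzeroSupport (affinePullback f M x) = ∅ := by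
  rcases le_total (density f) (1 / 2) with h | h
  · exact exists_constant_of_density_le_half _ _ f hf h rfl le_rfl
  · have hd : density (fun y => - f y) = 1 - density f := by
      rw [density, hat_neg, density]; ring
    obtain ⟨M, x, h1, h2⟩ := exists_constant_of_density_le_half
      ((nonzeroSupport f).card : ℝ) _ (fun y => - f y)
      (fun y => by rcases hf y with h | h <;> simp [h]) (by linarith) rfl
      (by rw [nonzeroSupport_neg])
    refine ⟨M, x, h1.trans ?_, ?_⟩
    · rw [hd]; gcongr; linarith
    · rw [← nonzeroSupport_neg]; exact h2

/-- If some restriction of `f` along `M` is constant, each nonzero fibre of `M` on the support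
has at least two elements. -/
lemma two_mul_card_foldedSupport_le {f : (Fin n → ZMod 2) → ℝ}
    {M : Matrix (Fin n) (Fin n) (ZMod 2)} {x : Fin n → ZMod 2}
    (h : nonzeroSupport (affinePullback f M x) = ∅) :
    2 * (foldedSupport f M).card ≤ (nonzeroSupport f).card := by
  have hfib : ∀ b ∈ foldedSupport f M,
      2 ≤ ((nonzeroSupport f).filter fun a => Matrix.vecMul a M = b).card := by
    intro b hb
    obtain ⟨hb0, a, ha, hab⟩ := (Finset.mem_filter.mp hb).2
    have hzero : hat (affinePullback f M x) b = 0 := by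
      by_contra hne
      have : b ∈ nonzeroSupport (affinePullback f M x) := by simp [nonzeroSupport, hb0, hne]
      simp [h] at this
    rw [hat_affinePullback] at hzero
    have ha0 : a ≠ 0 := by rintro rfl; exact hb0 (by simpa using hab.symm)
    obtain ⟨a', ha', hne', hterm⟩ : ∃ a' ∈ Finset.univ.filter fun a => Matrix.vecMul a M = b,
        a' ≠ a ∧ hat f a' * chi a' x ≠ 0 := by
      by_contra hcon
      push Not at hcon
      rw [Finset.sum_eq_single_of_mem a (by simp [hab]) hcon] at hzero
      exact mul_ne_zero ha (chi_ne_zero a x) hzero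
    have hab' : Matrix.vecMul a' M = b := (Finset.mem_filter.mp ha').2
    have ha'0 : a' ≠ 0 := by rintro rfl; exact hb0 (by simpa using hab'.symm)
    refine Finset.one_lt_card.mpr ⟨a', ?_, a, ?_, hne'⟩
    · simp [nonzeroSupport, hab', ha'0, left_ne_zero_of_mul hterm]
    · simp [nonzeroSupport, hab, ha0, ha]
  calc 2 * (foldedSupport f M).card = ∑ b ∈ foldedSupport f M, 2 := by simp [mul_comm]
    _ ≤ ∑ b ∈ foldedSupport f M,
        ((nonzeroSupport f).filter fun a => Matrix.vecMul a M = b).card :=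
      Finset.sum_le_sum hfib
    _ ≤ _ := sum_card_fiber_le_card _ _ _

lemma sum_density_affinePullback (f : (Fin n → ZMod 2) → ℝ)
    (M : Matrix (Fin n) (Fin n) (ZMod 2)) :
    ∑ x, density (affinePullback f M x) = 2 ^ n * density f := by
  have : ∑ x, hat (affinePullback f M x) 0 = 2 ^ n * hat f 0 := by
    simp only [hat_affinePullback]
    rw [Finset.sum_comm]
    simp only [← Finset.mul_sum, sum_chi]
    rw [Finset.sum_eq_single_of_mem 0 (by simp) (fun a _ h => by simp [h])]
    simp [mul_comm]
  simp only [density]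
  rw [← Finset.sum_div, Finset.sum_sub_distrib, this]
  simp only [Finset.sum_const, Finset.card_univ, nsmul_eq_mul, mul_one, card_vec]
  ring

/-- A random restriction keeps many of the folded characters alive. -/
lemma sum_card_nonzeroSupport_affinePullback (f : (Fin n → ZMod 2) → ℝ)
    (M : Matrix (Fin n) (Fin n) (ZMod 2)) :
    2 ^ n * ((foldedSupport f M).card : ℝ) ^ 2 ≤
      (nonzeroSupport f).card *
        ∑ x, ((nonzeroSupport (affinePullback f M x)).card : ℝ) := by
  set B := foldedSupport f M with hB
  let A : (Fin n → ZMod 2) → Finset (Fin n → ZMod 2) := fun b =>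
    (nonzeroSupport f).filter fun a => Matrix.vecMul a M = b
  have hhat : ∀ b ∈ B, ∀ x,
      hat (affinePullback f M x) b = ∑ a ∈ A b, hat f a * chi a x := by
    intro b hb x
    have hb0 := (Finset.mem_filter.mp hb).2.1
    rw [hat_affinePullback]
    symm
    refine Finset.sum_subset (fun a ha => ?_) (fun a ha hna => ?_)
    · simp only [A, Finset.mem_filter] at ha; simp [ha.2]
    · have hab : Matrix.vecMul a M = b := (Finset.mem_filter.mp ha).2
      have ha0 : a ≠ 0 := by rintro rfl; exact hb0 (by simpa using hab.symm)
      have : hat f a = 0 := by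
        by_contra hne
        exact hna (by simp [A, nonzeroSupport, hab, ha0, hne])
      rw [this, zero_mul]
  let w : (Fin n → ZMod 2) → ℝ := fun b =>
    (Finset.univ.filter fun x => hat (affinePullback f M x) b ≠ 0).card
  have hApos : ∀ b ∈ B, ∃ a ∈ A b, hat f a ≠ 0 := by
    intro b hb
    obtain ⟨hb0, a, ha, hab⟩ := (Finset.mem_filter.mp hb).2
    have ha0 : a ≠ 0 := by rintro rfl; exact hb0 (by simpa using hab.symm)
    exact ⟨a, by simp [A, nonzeroSupport, hab, ha0, ha], ha⟩
  have hw : ∀ b ∈ B, (2 : ℝ) ^ n ≤ (A b).card * w b := by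
    intro b hb
    have := two_pow_le_card_mul_card_ne_zero (A b) (hat f) (hApos b hb)
    simpa only [w, hhat b hb] using this
  have hsum : ∑ x, ((nonzeroSupport (affinePullback f M x)).card : ℝ) = ∑ b ∈ B, w b := by
    have h1 : ∀ x, nonzeroSupport (affinePullback f M x) =
        B.filter fun b => hat (affinePullback f M x) b ≠ 0 := by
      intro x
      ext b
      constructor
      · intro hb
        exact Finset.mem_filter.mpr ⟨nonzeroSupport_affinePullback_subset f M x hb,
          (Finset.mem_filter.mp hb).2.2⟩
      · intro hb
        obtain ⟨hb, hne⟩ := Finset.mem_filter.mp hb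
        simp [nonzeroSupport, (Finset.mem_filter.mp hb).2.1, hne]
    simp only [h1, w]
    exact_mod_cast Finset.sum_card_bipartiteAbove_eq_sum_card_bipartiteBelow
      (s := Finset.univ) (t := B) (fun x b => hat (affinePullback f M x) b ≠ 0)
  have hAsum : ∑ b ∈ B, ((A b).card : ℝ) ≤ (nonzeroSupport f).card := by
    exact_mod_cast sum_card_fiber_le_card (nonzeroSupport f) B
      (fun a => Matrix.vecMul a M)
  have hcs : (2 : ℝ) ^ n * (B.card : ℝ) ^ 2 ≤ (∑ b ∈ B, ((A b).card : ℝ)) * ∑ b ∈ B, w b := by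
    have h := Finset.sum_sq_le_sum_mul_sum_of_sq_le_mul B (r := fun _ => √((2 : ℝ) ^ n))
      (f := fun b => ((A b).card : ℝ)) (g := w) (fun _ _ => by positivity)
      (fun _ _ => by positivity)
      (fun b hb => by rw [Real.sq_sqrt (by positivity)]; exact hw b hb)
    rw [Finset.sum_const, nsmul_eq_mul, mul_pow, Real.sq_sqrt (by positivity)] at h
    linarith
  rw [hsum]
  exact hcs.trans (mul_le_mul_of_nonneg_right hAsum
    (Finset.sum_nonneg fun _ _ => by positivity))

lemma exists_good_restriction {f : (Fin n → ZMod 2) → ℝ} (hf : ∀ y, f y = 1 ∨ f y = -1)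
    (M : Matrix (Fin n) (Fin n) (ZMod 2)) (hu : 0 < (foldedSupport f M).card) :
    ∃ x, 0 < (nonzeroSupport (affinePullback f M x)).card ∧
      density (affinePullback f M x) * ((foldedSupport f M).card : ℝ) ^ 2 ≤
        (nonzeroSupport f).card * density f *
          (nonzeroSupport (affinePullback f M x)).card := by
  by_contra hcon
  push Not at hcon
  set u : ℝ := ((foldedSupport f M).card : ℝ) with hu_def
  have hu' : 0 < u := Nat.cast_pos.mpr hu
  have hsum := sum_card_nonzeroSupport_affinePullback f M
  have hδ := density_nonneg hf
  have hle : ∀ x, (nonzeroSupport f).card * density f *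
      ((nonzeroSupport (affinePullback f M x)).card : ℝ) ≤
        density (affinePullback f M x) * u ^ 2 := by
    intro x
    rcases Nat.eq_zero_or_pos (nonzeroSupport (affinePullback f M x)).card with h | h
    · rw [h]
      have := density_nonneg (affinePullback_eq_one_or hf M x)
      simp only [Nat.cast_zero, mul_zero]
      positivity
    · exact (hcon x h).le
  obtain ⟨x₀, hx₀⟩ : ∃ x, 0 < (nonzeroSupport (affinePullback f M x)).card := by
    by_contra h
    push Not at h
    have h0 : ∀ x, (nonzeroSupport (affinePullback f M x)).card = 0 := fun x => by
      have := h x; omega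
    simp only [h0, Nat.cast_zero, Finset.sum_const_zero, mul_zero] at hsum
    have : 0 < 2 ^ n * u ^ 2 := by positivity
    linarith
  have hlt := Finset.sum_lt_sum (fun x (_ : x ∈ Finset.univ) => hle x)
    ⟨x₀, Finset.mem_univ _, hcon x₀ hx₀⟩
  rw [← Finset.mul_sum, ← Finset.sum_mul, sum_density_affinePullback] at hlt
  have := mul_le_mul_of_nonneg_left hsum hδ
  linarith

/-- One round of folding: the number of nonzero folded characters drops, at a cost in dimension
proportional to the relative drop. -/
lemma exists_refinement {f : (Fin n → ZMod 2) → ℝ} (hf : ∀ y, f y = 1 ∨ f y = -1)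
    (M : Matrix (Fin n) (Fin n) (ZMod 2)) (hu : 0 < (foldedSupport f M).card) :
    ∃ M', (foldedSupport f M').card < (foldedSupport f M).card ∧
      (kerDim M' : ℝ) ≤ kerDim M + 6 * √((nonzeroSupport f).card * density f) *
        (((foldedSupport f M).card - (foldedSupport f M').card : ℝ) /
          (foldedSupport f M).card) := by
  obtain ⟨x, hpos, hx⟩ := exists_good_restriction hf M hu
  set g := affinePullback f M x with hg
  have hgb : ∀ y, g y = 1 ∨ g y = -1 := affinePullback_eq_one_or hf M x
  obtain ⟨N, z, hN, hz⟩ := exists_constant hgb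
  have h2 := two_mul_card_foldedSupport_le hz
  have hS : nonzeroSupport g ⊆ foldedSupport f M := nonzeroSupport_affinePullback_subset f M x
  have hsub : foldedSupport f (M * N) ⊆ foldedSupport g N ∪
      (foldedSupport f M \ nonzeroSupport g).image (fun b => Matrix.vecMul b N) := by
    intro c hc
    obtain ⟨hc0, a, ha, hac⟩ := (Finset.mem_filter.mp hc).2
    rw [← Matrix.vecMul_vecMul] at hac
    have hb0 : Matrix.vecMul a M ≠ 0 := by
      intro h; rw [h, Matrix.zero_vecMul] at hac; exact hc0 hac.symm
    by_cases hmem : Matrix.vecMul a M ∈ nonzeroSupport g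
    · refine Finset.mem_union_left _ (Finset.mem_filter.mpr ⟨Finset.mem_univ _, hc0, _, ?_, hac⟩)
      exact (Finset.mem_filter.mp hmem).2.2
    · refine Finset.mem_union_right _ (Finset.mem_image.mpr ⟨_, ?_, hac⟩)
      exact Finset.mem_sdiff.mpr
        ⟨Finset.mem_filter.mpr ⟨Finset.mem_univ _, hb0, a, ha, rfl⟩, hmem⟩
  have hcard : (foldedSupport f (M * N)).card + (nonzeroSupport g).card ≤
      (foldedSupport g N).card + (foldedSupport f M).card := by
    have h3 := (Finset.card_le_card hsub).trans (Finset.card_union_le _ _)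
    have h4 := Finset.card_image_le (s := foldedSupport f M \ nonzeroSupport g)
      (f := fun b => Matrix.vecMul b N)
    have h5 := Finset.card_sdiff_add_card_eq_card hS
    omega
  have hdrop : (nonzeroSupport g).card + 2 * (foldedSupport f (M * N)).card ≤
      2 * (foldedSupport f M).card := by omega
  refine ⟨M * N, by omega, ?_⟩
  have hker : (kerDim (M * N) : ℝ) ≤ kerDim M + kerDim N := by
    exact_mod_cast kerDim_mul_le M N
  set u : ℝ := ((foldedSupport f M).card : ℝ) with hu_def
  set u' : ℝ := ((foldedSupport f (M * N)).card : ℝ) with hu'_def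
  set t : ℝ := ((nonzeroSupport g).card : ℝ) with ht_def
  set E : ℝ := (nonzeroSupport f).card * density f with hE
  have hu' : 0 < u := Nat.cast_pos.mpr hu
  have hdrop' : t + 2 * u' ≤ 2 * u := by rw [ht_def, hu_def, hu'_def]; exact_mod_cast hdrop
  have hE0 : 0 ≤ E := mul_nonneg (Nat.cast_nonneg _) (density_nonneg hf)
  have ht0 : 0 ≤ t := Nat.cast_nonneg _
  have hsq : √(t * density g) ≤ t * √E / u := by
    apply Real.sqrt_le_iff.mpr
    refine ⟨by positivity, ?_⟩
    rw [div_pow, mul_pow, Real.sq_sqrt hE0, le_div_iff₀ (by positivity)]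
    nlinarith [mul_le_mul_of_nonneg_left hx ht0]
  have hfin : 3 * (t * √E / u) ≤ 6 * √E * ((u - u') / u) := by
    have : 6 * √E * ((u - u') / u) - 3 * (t * √E / u) = 3 * √E * (2 * u - 2 * u' - t) / u := by
      ring
    have h6 : 0 ≤ 3 * √E * (2 * u - 2 * u' - t) / u := by
      apply div_nonneg (mul_nonneg (by positivity) (by linarith)) hu'.le
    linarith
  linarith

lemma sub_div_le_harmonic_sub {u v : ℕ} (huv : v ≤ u) :
    ((u : ℝ) - v) / u ≤ (harmonic u : ℝ) - harmonic v := by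
  induction u, huv using Nat.le_induction with
  | base => simp
  | succ u huv ih =>
    rw [harmonic_succ]
    push_cast
    have hvu : (v : ℝ) ≤ u := by exact_mod_cast huv
    have h1 : ((u : ℝ) - v) / (u + 1) ≤ ((u : ℝ) - v) / u := by
      rcases Nat.eq_zero_or_pos u with h | h
      · subst h
        have : v = 0 := by omega
        simp [this]
      · have : (0 : ℝ) < u := by exact_mod_cast h
        exact div_le_div_of_nonneg_left (by linarith) this (by linarith)
    have h2 : ((u : ℝ) + 1 - v) / (u + 1) = ((u : ℝ) - v) / (u + 1) + ((u : ℝ) + 1)⁻¹ := by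
      ring
    linarith

lemma exists_fold_all {f : (Fin n → ZMod 2) → ℝ} (hf : ∀ y, f y = 1 ∨ f y = -1) (u : ℕ) :
    ∀ M, (foldedSupport f M).card = u → ∃ M', foldedSupport f M' = ∅ ∧
      (kerDim M' : ℝ) ≤ kerDim M +
        6 * √((nonzeroSupport f).card * density f) * (harmonic u : ℝ) := by
  induction u using Nat.strong_induction_on with
  | _ u ih =>
    intro M hM
    rcases Nat.eq_zero_or_pos u with h0 | hpos
    · refine ⟨M, Finset.card_eq_zero.mp (hM.trans h0), ?_⟩
      simp [h0]
    · obtain ⟨M₁, hlt, hker⟩ := exists_refinement hf M (hM ▸ hpos)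
      rw [hM] at hlt hker
      obtain ⟨M', he, hker'⟩ := ih _ hlt M₁ rfl
      refine ⟨M', he, ?_⟩
      have hh := mul_le_mul_of_nonneg_left (sub_div_le_harmonic_sub hlt.le)
        (by positivity : 0 ≤ 6 * √((nonzeroSupport f).card * density f))
      linarith

/-- The Fourier support of a Boolean function lies in a subspace of dimension
`O(√(k δ) log k)`. -/
lemma finrank_span_support_le {f : (Fin n → ZMod 2) → ℝ} (hf : ∀ y, f y = 1 ∨ f y = -1) :
    (Module.finrank (ZMod 2) (Submodule.span (ZMod 2) {a | hat f a ≠ 0}) : ℝ) ≤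
      6 * √((nonzeroSupport f).card * density f) * (harmonic (nonzeroSupport f).card : ℝ) := by
  have h1 : foldedSupport f 1 = nonzeroSupport f := by
    ext b
    simp [foldedSupport, nonzeroSupport]
  obtain ⟨M, hM, hker⟩ := exists_fold_all hf _ 1 rfl
  rw [h1, kerDim_one, Nat.cast_zero, zero_add] at hker
  refine le_trans ?_ hker
  have hle : Submodule.span (ZMod 2) {a | hat f a ≠ 0} ≤ LinearMap.ker M.vecMulLinear := by
    rw [Submodule.span_le]
    intro a ha
    by_contra hne
    have : Matrix.vecMul a M ∈ foldedSupport f M :=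
      Finset.mem_filter.mpr ⟨Finset.mem_univ _, by simpa using hne, a, ha, rfl⟩
    simp [hM] at this
  exact_mod_cast Submodule.finrank_mono hle

end Folding

section Transfer

variable {n : ℕ}

/-- The identification of `F₂ⁿ` with the Boolean cube. -/
def cubeEquiv (n : ℕ) : (Fin n → ZMod 2) ≃ (Fin n → Bool) :=
  Equiv.arrowCongr (Equiv.refl _) finTwoEquiv

lemma signv_finTwoEquiv (a : ZMod 2) : signv (finTwoEquiv a) = sgn a := by
  by_cases h : a = 0
  · have h0 : finTwoEquiv (0 : ZMod 2) = false := rfl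
    rw [h, h0]
    simp [signv, sgn]
  · have h1 : finTwoEquiv (1 : ZMod 2) = true := rfl
    rw [zmod_two_eq_one h, h1]
    simp [signv, sgn]

lemma prod_signv_cubeEquiv (S : Finset (Fin n)) (y : Fin n → ZMod 2) :
    ∏ i ∈ S, signv (cubeEquiv n y i) = chi (indicatorVec S) y := by
  have : indicatorVec S ⬝ᵥ y = ∑ i ∈ S, y i := by
    simp [dotProduct, indicatorVec]
  rw [chi, this, sgn_sum]
  exact Finset.prod_congr rfl fun i _ => signv_finTwoEquiv (y i)

lemma hat_comp_cubeEquiv (f : (Fin n → Bool) → ℝ) (S : Finset (Fin n)) :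
    hat (f ∘ cubeEquiv n) (indicatorVec S) = fourierCoeff f S := by
  rw [hat, fourierCoeff, ← Equiv.sum_comp (cubeEquiv n)]
  simp only [prod_signv_cubeEquiv, Function.comp_apply]

lemma indicatorVec_bijective : Function.Bijective (indicatorVec (n := n)) := by
  constructor
  · intro S T h
    ext i
    have := congrFun h i
    by_cases hS : i ∈ S <;> by_cases hT : i ∈ T <;> simp_all [indicatorVec]
  · intro a
    refine ⟨Finset.univ.filter fun i => a i ≠ 0, ?_⟩
    funext i
    by_cases h : a i = 0
    · simp [indicatorVec, h]
    · simp [indicatorVec, zmod_two_eq_one h]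

lemma indicatorVec_image_fourierSupport (f : (Fin n → Bool) → ℝ) :
    indicatorVec '' (fourierSupport f : Set (Finset (Fin n))) =
      {a | hat (f ∘ cubeEquiv n) a ≠ 0} := by
  ext a
  obtain ⟨S, rfl⟩ := indicatorVec_bijective.2 a
  rw [indicatorVec_bijective.1.mem_set_image]
  simp [fourierSupport, hat_comp_cubeEquiv]

lemma sparsity_eq (f : (Fin n → Bool) → ℝ) :
    sparsity f = (Finset.univ.filter fun a => hat (f ∘ cubeEquiv n) a ≠ 0).card := by
  rw [sparsity, ← Finset.card_image_of_injective _ indicatorVec_bijective.1]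
  congr 1
  rw [← Finset.coe_inj, Finset.coe_image, indicatorVec_image_fourierSupport]
  simp

lemma nonzeroSupport_eq_erase (f : (Fin n → ZMod 2) → ℝ) :
    nonzeroSupport f = (Finset.univ.filter fun a => hat f a ≠ 0).erase 0 := by
  ext a; simp [nonzeroSupport]

lemma weight_eq_density {f : (Fin n → Bool) → ℝ} (hf : IsBooleanFunc f) :
    weight f = density (f ∘ cubeEquiv n) := by
  have h2 : (2 : ℝ) ^ n ≠ 0 := by positivity
  have h1 : ∀ x, f x = 1 - 2 * (if f x = -1 then 1 else 0) := by
    intro x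
    rcases hf x with h | h <;> rw [h] <;> norm_num
  have hsum : ∑ x, f x
      = 2 ^ n - 2 * ((Finset.univ.filter fun x : Fin n → Bool => f x = -1).card : ℝ) := by
    rw [Finset.sum_congr rfl fun x _ => h1 x, Finset.sum_sub_distrib, ← Finset.mul_sum,
      Finset.sum_boole]
    simp
  have hz : hat (f ∘ cubeEquiv n) 0 = (∑ x, f x) / 2 ^ n := by
    rw [hat, ← Equiv.sum_comp (cubeEquiv n)]
    simp [chi_zero_left]
  rw [density, hz, hsum, weight]
  field_simp
  ring

lemma harmonic_le_two_mul_logb {m k : ℕ} (hm : m ≤ k) (hk : 1 < k) :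
    (harmonic m : ℝ) ≤ 2 * Real.logb 2 k := by
  have hk' : (2 : ℝ) ≤ k := by exact_mod_cast hk
  have hlog1 : 1 ≤ Real.logb 2 k := by
    rw [Real.le_logb_iff_rpow_le (by norm_num) (by linarith)]
    simpa using hk'
  rcases Nat.eq_zero_or_pos m with h0 | hpos
  · subst h0; simp only [harmonic_zero, Rat.cast_zero]; linarith
  · have h1 := harmonic_le_one_add_log m
    have h2 : Real.log m ≤ Real.log k :=
      Real.log_le_log (by exact_mod_cast hpos) (by exact_mod_cast hm)
    have h3 : Real.log k ≤ Real.logb 2 k := by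
      rw [Real.logb, le_div_iff₀ (Real.log_pos (by norm_num))]
      have := Real.log_two_lt_d9
      nlinarith [Real.log_nonneg (by linarith : (1 : ℝ) ≤ k)]
    linarith

lemma fourierRank_sq_le {f : (Fin n → Bool) → ℝ} (hf : IsBooleanFunc f)
    (hk : 1 < sparsity f) :
    (1 / (sparsity f : ℝ)) * ((fourierRank f : ℝ) / Real.logb 2 (sparsity f)) ^ 2
      ≤ 144 * weight f := by
  have hF : ∀ y, (f ∘ cubeEquiv n) y = 1 ∨ (f ∘ cubeEquiv n) y = -1 := fun y => hf _
  have hr := finrank_span_support_le hF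
  rw [← indicatorVec_image_fourierSupport, ← weight_eq_density hf] at hr
  have hm : (nonzeroSupport (f ∘ cubeEquiv n)).card ≤ sparsity f := by
    rw [sparsity_eq, nonzeroSupport_eq_erase]
    exact Finset.card_le_card (Finset.erase_subset _ _)
  have hw : 0 ≤ weight f := weight_eq_density hf ▸ density_nonneg hF
  have hk0 : (0 : ℝ) < sparsity f := by exact_mod_cast (by omega : 0 < sparsity f)
  have hL : 0 < Real.logb 2 (sparsity f) :=
    Real.logb_pos (by norm_num) (by exact_mod_cast hk)
  have hmain : (fourierRank f : ℝ) ≤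
      6 * √(sparsity f * weight f) * (2 * Real.logb 2 (sparsity f)) := by
    refine hr.trans ?_
    have h1 : √((nonzeroSupport (f ∘ cubeEquiv n)).card * weight f) ≤
        √(sparsity f * weight f) := by
      gcongr
    have h2 := harmonic_le_two_mul_logb hm hk
    have h3 : (0 : ℝ) ≤ (harmonic (nonzeroSupport (f ∘ cubeEquiv n)).card : ℝ) := by
      rw [harmonic]; push_cast; positivity
    exact mul_le_mul (by linarith) h2 h3 (by positivity)
  have hq : (fourierRank f : ℝ) / Real.logb 2 (sparsity f) ≤
      12 * √(sparsity f * weight f) := by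
    rw [div_le_iff₀ hL]; linarith
  have hq2 := pow_le_pow_left₀ (by positivity) hq 2
  rw [mul_pow, Real.sq_sqrt (by positivity)] at hq2
  rw [one_div, inv_mul_le_iff₀ hk0]
  linarith

lemma sparsity_div_maxSuppEntropy_sq_le {f : (Fin n → Bool) → ℝ} (hf : IsBooleanFunc f)
    (hk : 1 < sparsity f) :
    (sparsity f : ℝ) / (maxSuppEntropy f) ^ 2 ≤ 8 * weight f := by
  have hF : ∀ y, (f ∘ cubeEquiv n) y = 1 ∨ (f ∘ cubeEquiv n) y = -1 := fun y => hf _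
  have hbound : ∀ S ∈ fourierSupport f, 1 / |fourierCoeff f S| ≤ maxSuppEntropy f := by
    intro S hS
    exact le_csSup ((fourierSupport f).finite_toSet.image _).bddAbove
      (Set.mem_image_of_mem _ hS)
  have hpos : 0 < maxSuppEntropy f := by
    obtain ⟨S, hS⟩ := Finset.card_pos.mp (lt_trans Nat.zero_lt_one hk)
    have hne : fourierCoeff f S ≠ 0 := (Finset.mem_filter.mp hS).2
    exact lt_of_lt_of_le (by positivity) (hbound S hS)
  have hcoeff : ∀ a ∈ nonzeroSupport (f ∘ cubeEquiv n),
      1 / maxSuppEntropy f ^ 2 ≤ hat (f ∘ cubeEquiv n) a ^ 2 := by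
    intro a ha
    have hne := (Finset.mem_filter.mp ha).2.2
    obtain ⟨S, rfl⟩ := indicatorVec_bijective.2 a
    rw [hat_comp_cubeEquiv] at hne ⊢
    have h := hbound S (by simpa [fourierSupport] using hne)
    have h' : 1 / maxSuppEntropy f ≤ |fourierCoeff f S| :=
      (one_div_le (abs_pos.mpr hne) hpos).mp h
    rw [← sq_abs (fourierCoeff f S), ← one_div_pow]
    exact pow_le_pow_left₀ (by positivity) h' 2
  have hsum := Finset.card_nsmul_le_sum _ _ _ hcoeff
  rw [nsmul_eq_mul, sum_sq_nonzeroSupport hF, ← weight_eq_density hf] at hsum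
  have hcard : sparsity f ≤ 2 * (nonzeroSupport (f ∘ cubeEquiv n)).card := by
    have := Finset.pred_card_le_card_erase (a := (0 : Fin n → ZMod 2))
      (s := Finset.univ.filter fun a => hat (f ∘ cubeEquiv n) a ≠ 0)
    rw [← nonzeroSupport_eq_erase, ← sparsity_eq] at this
    omega
  have hcard' : (sparsity f : ℝ) ≤ 2 * (nonzeroSupport (f ∘ cubeEquiv n)).card := by
    exact_mod_cast hcard
  have hinv : 0 ≤ 1 / maxSuppEntropy f ^ 2 := by positivity
  rw [div_eq_mul_one_div]
  nlinarith [mul_le_mul_of_nonneg_right hcard' hinv, sq_nonneg (weight f)]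

end Transfer

/-- **Theorem.** There is a universal constant `c > 0` such that every Boolean function
`f` with `k(f) > 1` satisfies
`δ(f) ≥ c · max{ (1/k(f)) · (r(f)/log₂ k(f))² , k(f)/k'(f)² }`. -/
theorem delta_lower_bound_rank_sparsity_maxSuppEntropy :
    ∃ c : ℝ, 0 < c ∧
      ∀ (n : ℕ), 0 < n → ∀ f : (Fin n → Bool) → ℝ, IsBooleanFunc f →
        1 < sparsity f →
        c * max ((1 / (sparsity f : ℝ)) *
              ((fourierRank f : ℝ) / Real.logb 2 (sparsity f)) ^ 2)
            ((sparsity f : ℝ) / (maxSuppEntropy f) ^ 2) ≤ weight f := by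
  refine ⟨1 / 144, by norm_num, fun n _ f hf hk => ?_⟩
  have h1 := fourierRank_sq_le hf hk
  have h2 := sparsity_div_maxSuppEntropy_sq_le hf hk
  have hw : 0 ≤ weight f := by rw [weight]; positivity
  have := max_le h1 (h2.trans (by linarith : 8 * weight f ≤ 144 * weight f))
  linarith

end BoolFunc

end
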